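/- Every W-orbit of 10-element cliques in C with weights in {1,2} contains a clique that contains the four exceptional classes (1,1,1,0,0,0,0,0,0), (1,0,0,1,1,0,0,0,0), (1,0,0,0,0,1,1,0,0), and (1,0,0,0,0,0,0,1,1) (the classes of the lines through pairs of blown-up points l_{1,2}, l_{3,4}, l_{5,6}, l_{7,8}). -/

import Mathlib

/-- The intersection pairing on `ℤ⁹`, the Picard lattice of a del Pezzo surface of degree 1. -/
def B (v w : Fin 9 → ℤ) : ℤ := v 0 * w 0 - ∑ i : Fin 8, v i.succ * w i.succ

/-- The canonical class `K = (-3, -1, …, -1)`. -/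
def Kcl : Fin 9 → ℤ := fun i => if i = 0 then -3 else -1

/-- A vector is an exceptional class if `B(v,v) = -1` and `B(v,K) = -1`. -/
def IsExc (v : Fin 9 → ℤ) : Prop := B v v = -1 ∧ B v Kcl = -1

/-- The type of exceptional classes (the set `C`). -/
abbrev Exc : Type := {v : Fin 9 → ℤ // IsExc v}

/-- The pairing on exceptional classes. -/
def Bx (x y : Exc) : ℤ := B x.1 y.1

/-- `S` is a clique with weights in `M` if `B(x,y) ∈ M` for all distinct `x, y ∈ S`. -/
def IsClique (M : Set ℤ) (S : Finset Exc) : Prop :=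
  ∀ x ∈ S, ∀ y ∈ S, x ≠ y → Bx x y ∈ M

/-- A bijection of `C` preserving the pairing `B`: an element of the Weyl group `W`. -/
def PreservesB (g : Exc ≃ Exc) : Prop := ∀ x y : Exc, Bx (g x) (g y) = Bx x y

/-- Two finite subsets of `C` lie in the same orbit of `W`. -/
def SameOrbit (S T : Finset Exc) : Prop :=
  ∃ g : Exc ≃ Exc, PreservesB g ∧ S.image g = T

/-- The class of the line `ℓ_{1,2}` through `P₁` and `P₂`. -/
def l12 : Fin 9 → ℤ := ![1, 1, 1, 0, 0, 0, 0, 0, 0]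
/-- The class of the line `ℓ_{3,4}`. -/
def l34 : Fin 9 → ℤ := ![1, 0, 0, 1, 1, 0, 0, 0, 0]
/-- The class of the line `ℓ_{5,6}`. -/
def l56 : Fin 9 → ℤ := ![1, 0, 0, 0, 0, 1, 1, 0, 0]
/-- The class of the line `ℓ_{7,8}`. -/
def l78 : Fin 9 → ℤ := ![1, 0, 0, 0, 0, 0, 0, 1, 1]

theorem B_comm (v w : Fin 9 → ℤ) : B v w = B w v := by
  simp only [B, mul_comm]

theorem B_add_left (u v w : Fin 9 → ℤ) : B (u + v) w = B u w + B v w := by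
  simp only [B, Pi.add_apply, add_mul, Finset.sum_add_distrib]; ring

theorem B_smul_left (n : ℤ) (v w : Fin 9 → ℤ) : B (n • v) w = n * B v w := by
  simp only [B, Pi.smul_apply, smul_eq_mul, mul_sub, Finset.mul_sum, mul_assoc]

theorem B_add_right (u v w : Fin 9 → ℤ) : B w (u + v) = B w u + B w v := by
  rw [B_comm, B_add_left, B_comm u, B_comm v]

theorem B_smul_right (n : ℤ) (v w : Fin 9 → ℤ) : B w (n • v) = n * B w v := by
  rw [B_comm, B_smul_left, B_comm v]

theorem B_sum_left {ι : Type} (F : Finset ι) (f : ι → Fin 9 → ℤ) (w : Fin 9 → ℤ) :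
    B (∑ i ∈ F, f i) w = ∑ i ∈ F, B (f i) w := by
  classical
  induction F using Finset.induction_on with
  | empty => simp [B]
  | insert a s ha ih => rw [Finset.sum_insert ha, Finset.sum_insert ha, B_add_left, ih]

theorem B_sum_right {ι : Type} (F : Finset ι) (f : ι → Fin 9 → ℤ) (w : Fin 9 → ℤ) :
    B w (∑ i ∈ F, f i) = ∑ i ∈ F, B w (f i) := by
  rw [B_comm, B_sum_left]; simp only [B_comm]

theorem B_KK : B Kcl Kcl = 1 := by decide

theorem negdef (v : Fin 9 → ℤ) (h : B v Kcl = 0) :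
    B v v ≤ 0 ∧ (B v v = 0 → v = 0) := by
  have h1 : (∑ i : Fin 8, v i.succ) = 3 * v 0 := by
    have : B v Kcl = -3 * v 0 + ∑ i : Fin 8, v i.succ := by
      simp [B, Kcl, Fin.succ_ne_zero]; ring
    linarith
  have h2 : (∑ i : Fin 8, v i.succ) ^ 2 ≤ 8 * ∑ i : Fin 8, v i.succ ^ 2 := by
    have := sq_sum_le_card_mul_sum_sq (s := (Finset.univ : Finset (Fin 8)))
      (f := fun i => v i.succ)
    simpa using this
  have h3 : B v v = v 0 ^ 2 - ∑ i : Fin 8, v i.succ ^ 2 := by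
    simp only [B, sq]
  have h4 : 0 ≤ ∑ i : Fin 8, v i.succ ^ 2 := Finset.sum_nonneg fun i _ => sq_nonneg _
  rw [h1] at h2
  refine ⟨by nlinarith, fun h0 => ?_⟩
  have h5 : ∑ i : Fin 8, v i.succ ^ 2 = 0 := by nlinarith
  have h6 : v 0 = 0 := by
    have : v 0 ^ 2 = 0 := by linarith
    exact pow_eq_zero_iff (two_ne_zero) |>.1 this
  have h7 := (Finset.sum_eq_zero_iff_of_nonneg (fun i _ => sq_nonneg (v (Fin.succ i)))).1 h5
  funext i
  refine Fin.cases h6 (fun j => ?_) i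
  exact pow_eq_zero_iff (two_ne_zero) |>.1 (h7 j (Finset.mem_univ j))

/-- The root attached to an exceptional class. -/
def rt (x : Exc) : Fin 9 → ℤ := x.1 + Kcl

/-- The pairing of the attached roots. -/
def cc (x y : Exc) : ℤ := Bx x y - 1

theorem B_rt (x y : Exc) : B (rt x) (rt y) = cc x y := by
  simp only [rt, cc, Bx, B_add_left, B_add_right, B_KK, B_comm Kcl y.1, x.2.2, y.2.2]; ring

theorem B_rt_K (x : Exc) : B (rt x) Kcl = 0 := by
  simp only [rt, B_add_left, B_KK, x.2.2]; ring

theorem cc_self (x : Exc) : cc x x = -2 := by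
  simp only [cc, Bx, x.2.1]; ring

theorem cc_comm (x y : Exc) : cc x y = cc y x := by
  simp only [cc, Bx, B_comm]

theorem rt_inj {x y : Exc} (h : rt x = rt y) : x = y :=
  Subtype.ext (add_right_cancel h)

/-- Reflection. -/
def refl9 (r v : Fin 9 → ℤ) : Fin 9 → ℤ := v + (B v r) • r

theorem refl9_B (r : Fin 9 → ℤ) (h : B r r = -2) (v w : Fin 9 → ℤ) :
    B (refl9 r v) (refl9 r w) = B v w := by
  simp only [refl9, B_add_left, B_add_right, B_smul_left, B_smul_right, h, B_comm r w]; ring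

theorem refl9_K (r : Fin 9 → ℤ) (h : B r Kcl = 0) : refl9 r Kcl = Kcl := by
  simp [refl9, B_comm Kcl, h]

theorem refl9_invol (r : Fin 9 → ℤ) (h : B r r = -2) (v : Fin 9 → ℤ) :
    refl9 r (refl9 r v) = v := by
  funext i
  simp only [refl9, B_add_left, B_smul_left, h, Pi.add_apply, Pi.smul_apply, smul_eq_mul]; ring

theorem refl9_exc (r : Fin 9 → ℤ) (h : B r r = -2) (hK : B r Kcl = 0) (x : Exc) :
    IsExc (refl9 r x.1) := by
  refine ⟨by rw [refl9_B r h]; exact x.2.1, ?_⟩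
  have := refl9_B r h x.1 Kcl
  rw [refl9_K r hK] at this
  rw [this]; exact x.2.2

/-- Reflection as a bijection of the exceptional classes. -/
def reflE (r : Fin 9 → ℤ) (h : B r r = -2) (hK : B r Kcl = 0) : Exc ≃ Exc where
  toFun x := ⟨refl9 r x.1, refl9_exc r h hK x⟩
  invFun x := ⟨refl9 r x.1, refl9_exc r h hK x⟩
  left_inv x := Subtype.ext (refl9_invol r h x.1)
  right_inv x := Subtype.ext (refl9_invol r h x.1)

theorem reflE_pres (r : Fin 9 → ℤ) (h : B r r = -2) (hK : B r Kcl = 0) :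
    PreservesB (reflE r h hK) := fun x y => refl9_B r h x.1 y.1

theorem rt_reflE (r : Fin 9 → ℤ) (h : B r r = -2) (hK : B r Kcl = 0) (x : Exc) :
    rt (reflE r h hK x) = rt x + B (rt x) r • r := by
  have h1 : B (rt x) r = B x.1 r := by
    simp only [rt, B_add_left, B_comm Kcl r, hK, add_zero]
  rw [h1]
  change x.1 + B x.1 r • r + Kcl = x.1 + Kcl + B x.1 r • r
  abel

theorem reflE_fix (r : Fin 9 → ℤ) (h : B r r = -2) (hK : B r Kcl = 0) (z : Exc)
    (hz : B (rt z) r = 0) : reflE r h hK z = z := by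
  apply rt_inj
  rw [rt_reflE, hz, zero_smul, add_zero]

theorem cc_pres {g : Exc ≃ Exc} (h : PreservesB g) (x y : Exc) : cc (g x) (g y) = cc x y := by
  simp only [cc, h x y]

theorem pres_trans {g k : Exc ≃ Exc} (hg : PreservesB g) (hk : PreservesB k) :
    PreservesB (g.trans k) := fun x y => by
  simp only [Equiv.trans_apply]; rw [hk, hg]

/-- `x` can be moved to `t` by an isometry fixing everything in `Z`. -/
def Mv (Z : Set Exc) (x t : Exc) : Prop :=
  ∃ g : Exc ≃ Exc, PreservesB g ∧ g x = t ∧ ∀ z ∈ Z, g z = z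

theorem Mv.trans {Z : Set Exc} {x y t : Exc} (h : Mv Z x y) (h' : Mv Z y t) : Mv Z x t := by
  obtain ⟨g, hg, hx, hz⟩ := h
  obtain ⟨k, hk, hy, hz'⟩ := h'
  refine ⟨g.trans k, pres_trans hg hk, by simp [hx, hy], fun z hzz => ?_⟩
  simp [hz z hzz, hz' z hzz]

theorem mv_step {Z : Set Exc} {x t : Exc} (h : cc x t ≠ 0)
    (hx : ∀ z ∈ Z, cc z x = 0) (ht : ∀ z ∈ Z, cc z t = 0) : Mv Z x t := by
  have e1 : ∀ n : ℤ, B (rt x + n • rt t) (rt x + n • rt t) = -2 + 2 * n * cc x t - 2 * n ^ 2 := by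
    intro n
    simp only [B_add_left, B_add_right, B_smul_left, B_smul_right, B_rt, cc_self, cc_comm t x]
    ring
  have e2 : ∀ n : ℤ, B (rt x + n • rt t) Kcl = 0 := by
    intro n
    simp only [B_add_left, B_smul_left, B_rt_K]; ring
  have e3 : ∀ n : ℤ, ∀ z ∈ Z, B (rt z) (rt x + n • rt t) = 0 := by
    intro n z hz
    simp only [B_add_right, B_smul_right, B_rt, hx z hz, ht z hz]; ring
  have f1 := negdef _ (e2 1)
  have f2 := negdef _ (e2 (-1))
  rw [e1] at f1 f2
  have ht2 : B (rt t) (rt t) = -2 := by rw [B_rt, cc_self]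
  have hc : cc x t = -2 ∨ cc x t = -1 ∨ cc x t = 1 ∨ cc x t = 2 := by
    have := f1.1
    have := f2.1
    omega
  rcases hc with hc | hc | hc | hc
  · have : rt x + (-1 : ℤ) • rt t = 0 := f2.2 (by rw [hc]; norm_num)
    have : x = t := rt_inj (by
      have h9 : rt x - rt t = 0 := by simpa [sub_eq_add_neg] using this
      exact sub_eq_zero.1 h9)
    subst this
    exact ⟨Equiv.refl _, fun _ _ => rfl, rfl, fun _ _ => rfl⟩
  · have hr := e1 (-1)
    rw [hc] at hr
    norm_num at hr
    have hr' : B (rt x + (-1 : ℤ) • rt t) (rt x + (-1 : ℤ) • rt t) = -2 := by simpa using hr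
    refine ⟨reflE _ hr' (e2 _), reflE_pres _ _ _, ?_, fun z hz => reflE_fix _ _ _ z (e3 _ z hz)⟩
    apply rt_inj
    rw [rt_reflE, B_add_right, B_smul_right, B_rt, B_rt, hc, cc_self]
    simp
  · have hr' : B (rt x + (1 : ℤ) • rt t) (rt x + (1 : ℤ) • rt t) = -2 := by
      rw [e1, hc]; norm_num
    refine Mv.trans (y := reflE _ ht2 (B_rt_K t) t)
      ⟨reflE _ hr' (e2 _), reflE_pres _ _ _, ?_, fun z hz => reflE_fix _ _ _ z (e3 _ z hz)⟩
      ⟨reflE _ ht2 (B_rt_K t), reflE_pres _ _ _, ?_,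
        fun z hz => reflE_fix _ _ _ z (by rw [B_rt, ht z hz])⟩
    · apply rt_inj
      rw [rt_reflE, rt_reflE, B_add_right, B_smul_right, B_rt, B_rt, B_rt, hc, cc_self, cc_self]
      funext i
      simp only [Pi.add_apply, Pi.smul_apply, smul_eq_mul]; ring
    · exact Subtype.ext (refl9_invol _ ht2 t.1)
  · have h0 : rt x + (1 : ℤ) • rt t = 0 := f1.2 (by rw [hc]; norm_num)
    refine ⟨reflE _ ht2 (B_rt_K t), reflE_pres _ _ _, ?_,
        fun z hz => reflE_fix _ _ _ z (by rw [B_rt, ht z hz])⟩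
    apply rt_inj
    rw [rt_reflE, B_rt, hc]
    funext i
    have := congrFun h0 i
    simp only [Pi.add_apply, Pi.smul_apply, smul_eq_mul, Pi.zero_apply] at this ⊢
    linarith

/-- A quadruple whose attached roots sum to twice a root. -/
def Bad (a b c d : Exc) : Prop := ∃ z : Exc, cc z a = -1 ∧ cc z b = -1 ∧ cc z c = -1 ∧ cc z d = -1

theorem bad_id {z a b c d : Exc} (ha : cc z a = -1) (hb : cc z b = -1) (hc : cc z c = -1)
    (hd : cc z d = -1) (ab : cc a b = 0) (ac : cc a c = 0) (ad : cc a d = 0) (bc : cc b c = 0)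
    (bd : cc b d = 0) (cd : cc c d = 0) (e : Exc) :
    2 * cc z e = cc a e + cc b e + cc c e + cc d e := by
  have h0 : (-2 : ℤ) • rt z + (rt a + rt b + rt c + rt d) = 0 := by
    refine (negdef _ ?_).2 ?_
    · simp only [B_add_left, B_smul_left, B_rt_K]; ring
    · simp only [B_add_left, B_smul_left, B_add_right, B_smul_right, B_rt, cc_self,
        cc_comm b a, cc_comm c a, cc_comm d a, cc_comm c b, cc_comm d b, cc_comm d c,
        cc_comm a z, cc_comm b z, cc_comm c z, cc_comm d z, ha, hb, hc, hd, ab, ac, ad, bc, bd, cd]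
      norm_num
  have h1 : B ((-2 : ℤ) • rt z + (rt a + rt b + rt c + rt d)) (rt e) = 0 := by
    rw [h0]; simp [B]
  simp only [B_add_left, B_smul_left, B_rt] at h1
  linarith

theorem rank_sum (F : Finset Exc) : ∑ x ∈ F, ∑ y ∈ F, cc x y ≤ 0 := by
  have h := (negdef (∑ x ∈ F, rt x) (by rw [B_sum_left]; simp [B_rt_K])).1
  rw [B_sum_left] at h
  simpa only [B_sum_right, B_rt] using h

theorem low_deg (F : Finset Exc) (hne : F.Nonempty)
    (hF : ∀ x ∈ F, ∀ y ∈ F, x ≠ y → cc x y = 0 ∨ cc x y = 1) :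
    ∃ x ∈ F, F.card ≤ (F.filter fun y => cc x y = 0).card + 3 := by
  classical
  obtain ⟨x, hx, hs⟩ : ∃ x ∈ F, ∑ y ∈ F, cc x y ≤ 0 := by
    by_contra! hcon
    have := Finset.sum_pos hcon hne
    have := rank_sum F
    omega
  refine ⟨x, hx, ?_⟩
  have h1 : ∑ y ∈ F, ((1 : ℤ) - (if cc x y = 0 then 1 else 0) - 3 * (if y = x then 1 else 0))
      ≤ ∑ y ∈ F, cc x y := by
    apply Finset.sum_le_sum
    intro y hy
    by_cases hyx : y = x
    · subst hyx; simp [cc_self]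
    · rcases hF x hx y hy (Ne.symm hyx) with h | h <;> simp [h, hyx]
  rw [Finset.sum_sub_distrib, Finset.sum_sub_distrib, ← Finset.mul_sum, Finset.sum_ite_eq' F x,
    if_pos hx, Finset.sum_boole] at h1
  simp at h1
  omega

theorem exists_good (S : Finset Exc) (hcard : S.card = 10)
    (hF : ∀ x ∈ S, ∀ y ∈ S, x ≠ y → cc x y = 0 ∨ cc x y = 1) :
    ∃ a ∈ S, ∃ b ∈ S, ∃ c ∈ S, ∃ d ∈ S, cc a b = 0 ∧ cc a c = 0 ∧ cc a d = 0 ∧ cc b c = 0 ∧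
      cc b d = 0 ∧ cc c d = 0 ∧ ¬ Bad a b c d := by
  classical
  by_contra! hcon
  obtain ⟨a, ha, ca⟩ := low_deg S (Finset.card_pos.1 (by omega)) hF
  set F1 := S.filter fun y => cc a y = 0 with hF1
  have m1 : ∀ y ∈ F1, y ∈ S ∧ cc a y = 0 := fun y hy => Finset.mem_filter.1 hy
  obtain ⟨b, hb, cb⟩ := low_deg F1 (Finset.card_pos.1 (by omega))
    (fun x hx y hy => hF x (m1 x hx).1 y (m1 y hy).1)
  set F2 := F1.filter fun y => cc b y = 0 with hF2
  have m2 : ∀ y ∈ F2, y ∈ F1 ∧ cc b y = 0 := fun y hy => Finset.mem_filter.1 hy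
  obtain ⟨c, hc, hcc⟩ := low_deg F2 (Finset.card_pos.1 (by omega))
    (fun x hx y hy => hF x (m1 x (m2 x hx).1).1 y (m1 y (m2 y hy).1).1)
  obtain ⟨d, hd⟩ : (F2.filter fun y => cc c y = 0).Nonempty := Finset.card_pos.1 (by omega)
  obtain ⟨hd, cd⟩ := Finset.mem_filter.1 hd
  obtain ⟨hd, bd⟩ := m2 d hd
  obtain ⟨hd, ad⟩ := m1 d hd
  obtain ⟨hc, bc⟩ := m2 c hc
  obtain ⟨hc, ac⟩ := m1 c hc
  obtain ⟨hb, ab⟩ := m1 b hb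
  obtain ⟨z, za, zb, zc, zd⟩ := hcon a ha b hb c hc d hd ab ac ad bc bd cd
  have idz := bad_id za zb zc zd ab ac ad bc bd cd
  set E := S \ {a, b, c, d} with hE
  have hEc : 6 ≤ E.card := by
    have h1 : S.card - ({a, b, c, d} : Finset Exc).card ≤ E.card := Finset.le_card_sdiff _ _
    have h2 : ({a, b, c, d} : Finset Exc).card ≤ 4 := Finset.card_le_four
    omega
  have hEm : ∀ e ∈ E, e ∈ S ∧ e ≠ a ∧ e ≠ b ∧ e ≠ c ∧ e ≠ d := by
    intro e he
    simpa [hE] using he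
  have key : ∀ e ∈ E, 1 ≤ cc z e := by
    intro e he
    obtain ⟨heS, na, nb, nc, nd⟩ := hEm e he
    have i := idz e
    have ha' := hF a ha e heS na.symm
    have hb' := hF b hb e heS nb.symm
    have hc' := hF c hc e heS nc.symm
    have hd' := hF d hd e heS nd.symm
    by_contra hlt
    have ae : cc a e = 0 := by omega
    have be : cc b e = 0 := by omega
    have ce : cc c e = 0 := by omega
    have de : cc d e = 0 := by omega
    obtain ⟨w, wa, wb, wc, we⟩ := hcon a ha b hb c hc e heS ab ac ae bc be ce
    have i1 := bad_id wa wb wc we ab ac ae bc be ce d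
    have i2 := idz w
    rw [ad, bd, cd, cc_comm e d, de] at i1
    rw [cc_comm a w, cc_comm b w, cc_comm c w, cc_comm d w, wa, wb, wc] at i2
    omega
  have hpos := (negdef ((2 : ℤ) • rt z + ∑ e ∈ E, rt e) (by
    rw [B_add_left, B_smul_left, B_sum_left]; simp [B_rt_K])).1
  have ex : B ((2 : ℤ) • rt z + ∑ e ∈ E, rt e) ((2 : ℤ) • rt z + ∑ e ∈ E, rt e)
      = -8 + 4 * ∑ e ∈ E, cc z e + ∑ e ∈ E, ∑ f ∈ E, cc e f := by
    have q1 : B (rt z) (∑ e ∈ E, rt e) = ∑ e ∈ E, cc z e := by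
      rw [B_sum_right]; simp only [B_rt]
    have q2 : B (∑ e ∈ E, rt e) (∑ e ∈ E, rt e) = ∑ e ∈ E, ∑ f ∈ E, cc e f := by
      rw [B_sum_left]; simp only [B_sum_right, B_rt]
    simp only [B_add_left, B_smul_left, B_add_right, B_smul_right, q2, B_comm _ (rt z), q1,
      B_rt, cc_self]
    ring
  have s1 : (E.card : ℤ) ≤ ∑ e ∈ E, cc z e := by
    have := Finset.card_nsmul_le_sum E (fun e => cc z e) 1 key
    simpa using this
  have s2 : -2 * (E.card : ℤ) ≤ ∑ e ∈ E, ∑ f ∈ E, cc e f := by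
    have := Finset.card_nsmul_le_sum E (fun e => ∑ f ∈ E, cc e f) (-2) (by
      intro e he
      calc (-2 : ℤ) = ∑ f ∈ E, (if f = e then -2 else 0) := by
            rw [Finset.sum_ite_eq' E e, if_pos he]
        _ ≤ _ := by
            apply Finset.sum_le_sum
            intro f hf
            by_cases hfe : f = e
            · subst hfe; simp [cc_self]
            · rcases hF e (hEm e he).1 f (hEm f hf).1 (Ne.symm hfe) with h | h <;> simp [h, hfe])
    simp at this
    linarith
  rw [ex] at hpos
  have : (6 : ℤ) ≤ E.card := by exact_mod_cast hEc
  linarith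

theorem cc_exp (x y : Exc) : cc x y = x.1 0 * y.1 0 - (x.1 1 * y.1 1 + x.1 2 * y.1 2 +
    x.1 3 * y.1 3 + x.1 4 * y.1 4 + x.1 5 * y.1 5 + x.1 6 * y.1 6 + x.1 7 * y.1 7 +
    x.1 8 * y.1 8) - 1 := by
  simp only [cc, Bx, B, Fin.sum_univ_eight]; rfl

theorem sq_exp (x : Exc) : x.1 0 * x.1 0 - (x.1 1 * x.1 1 + x.1 2 * x.1 2 +
    x.1 3 * x.1 3 + x.1 4 * x.1 4 + x.1 5 * x.1 5 + x.1 6 * x.1 6 + x.1 7 * x.1 7 +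
    x.1 8 * x.1 8) = -1 := by
  have := cc_self x
  rw [cc_exp] at this
  linarith

theorem K_exp (x : Exc) : -3 * x.1 0 + (x.1 1 + x.1 2 + x.1 3 + x.1 4 + x.1 5 + x.1 6 +
    x.1 7 + x.1 8) = -1 := by
  have h : B x.1 Kcl = -3 * x.1 0 + ∑ i : Fin 8, x.1 i.succ := by
    simp [B, Kcl, Fin.succ_ne_zero]; ring
  rw [x.2.2, Fin.sum_univ_eight] at h
  exact h.symm

theorem mv_via {Z : Set Exc} {x t : Exc} (y : Exc) (h : cc x y ≠ 0) (h' : cc y t ≠ 0)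
    (hx : ∀ z ∈ Z, cc z x = 0) (hy : ∀ z ∈ Z, cc z y = 0) (ht : ∀ z ∈ Z, cc z t = 0) :
    Mv Z x t := (mv_step h hx hy).trans (mv_step h' hy ht)

def L1 : Exc := ⟨l12, by decide, by decide⟩
def L2 : Exc := ⟨l34, by decide, by decide⟩
def L3 : Exc := ⟨l56, by decide, by decide⟩
def L4 : Exc := ⟨l78, by decide, by decide⟩
def y00 : Exc := ⟨![1, 1, 1, 0, 0, 0, 0, 0, 0], by decide, by decide⟩
def y01 : Exc := ⟨![0, 0, 0, -1, 0, 0, 0, 0, 0], by decide, by decide⟩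
def y02 : Exc := ⟨![0, 0, 0, 0, -1, 0, 0, 0, 0], by decide, by decide⟩
def y03 : Exc := ⟨![0, 0, 0, 0, 0, -1, 0, 0, 0], by decide, by decide⟩
def y04 : Exc := ⟨![0, 0, 0, 0, 0, 0, -1, 0, 0], by decide, by decide⟩
def y05 : Exc := ⟨![0, 0, 0, 0, 0, 0, 0, -1, 0], by decide, by decide⟩
def y06 : Exc := ⟨![0, 0, 0, 0, 0, 0, 0, 0, -1], by decide, by decide⟩
def y07 : Exc := ⟨![1, 0, 1, 0, 0, 0, 0, 0, 1], by decide, by decide⟩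
def y10 : Exc := ⟨![1, 0, 0, 1, 1, 0, 0, 0, 0], by decide, by decide⟩
def y11 : Exc := ⟨![0, -1, 0, 0, 0, 0, 0, 0, 0], by decide, by decide⟩
def y12 : Exc := ⟨![0, 0, -1, 0, 0, 0, 0, 0, 0], by decide, by decide⟩
def y13 : Exc := ⟨![1, 0, 0, 0, 1, 0, 0, 0, 1], by decide, by decide⟩
def y14 : Exc := ⟨![1, 0, 0, 0, 1, 0, 0, 1, 0], by decide, by decide⟩
def y15 : Exc := ⟨![1, 0, 0, 0, 1, 0, 1, 0, 0], by decide, by decide⟩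
def y16 : Exc := ⟨![1, 0, 0, 0, 1, 1, 0, 0, 0], by decide, by decide⟩
def y20 : Exc := ⟨![1, 0, 0, 0, 0, 1, 1, 0, 0], by decide, by decide⟩
def y21 : Exc := ⟨![1, 0, 0, 0, 0, 0, 1, 0, 1], by decide, by decide⟩
def y22 : Exc := ⟨![1, 0, 0, 0, 0, 0, 1, 1, 0], by decide, by decide⟩
def y23 : Exc := ⟨![1, 0, 0, 0, 0, 1, 0, 0, 1], by decide, by decide⟩
def y24 : Exc := ⟨![2, 0, 1, 0, 1, 1, 1, 0, 1], by decide, by decide⟩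
def y25 : Exc := ⟨![2, 0, 1, 1, 0, 1, 1, 0, 1], by decide, by decide⟩
def y30 : Exc := ⟨![1, 0, 0, 0, 0, 0, 0, 1, 1], by decide, by decide⟩
def y31 : Exc := ⟨![2, 0, 1, 0, 1, 0, 1, 1, 1], by decide, by decide⟩
def y32 : Exc := ⟨![2, 0, 1, 0, 1, 1, 0, 1, 1], by decide, by decide⟩
def y33 : Exc := ⟨![2, 0, 1, 1, 0, 0, 1, 1, 1], by decide, by decide⟩

theorem stage0 (x : Exc) : Mv (∅ : Set Exc) x L1 := by
  by_contra hcon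
  have g0 : cc x y00 = 0 := by
    by_contra hne
    refine hcon (mv_via y00 hne (by decide) ?_ ?_ ?_)
    all_goals simp
  have g1 : cc x y01 = 0 := by
    by_contra hne
    refine hcon (mv_via y01 hne (by decide) ?_ ?_ ?_)
    all_goals simp
  have g2 : cc x y02 = 0 := by
    by_contra hne
    refine hcon (mv_via y02 hne (by decide) ?_ ?_ ?_)
    all_goals simp
  have g3 : cc x y03 = 0 := by
    by_contra hne
    refine hcon (mv_via y03 hne (by decide) ?_ ?_ ?_)
    all_goals simp
  have g4 : cc x y04 = 0 := by
    by_contra hne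
    refine hcon (mv_via y04 hne (by decide) ?_ ?_ ?_)
    all_goals simp
  have g5 : cc x y05 = 0 := by
    by_contra hne
    refine hcon (mv_via y05 hne (by decide) ?_ ?_ ?_)
    all_goals simp
  have g6 : cc x y06 = 0 := by
    by_contra hne
    refine hcon (mv_via y06 hne (by decide) ?_ ?_ ?_)
    all_goals simp
  have g7 : cc x y07 = 0 := by
    by_contra hne
    refine hcon (mv_via y07 hne (by decide) ?_ ?_ ?_)
    all_goals simp
  have hK := K_exp x
  have hs := sq_exp x
  simp [cc_exp, y00, y01, y02, y03, y04, y05, y06, y07, ] at g0 g1 g2 g3 g4 g5 g6 g7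
  have e0 : x.1 0 = 3 := by omega
  have e1 : x.1 1 = 1 := by omega
  have e2 : x.1 2 = 1 := by omega
  have e3 : x.1 3 = 1 := by omega
  have e4 : x.1 4 = 1 := by omega
  have e5 : x.1 5 = 1 := by omega
  have e6 : x.1 6 = 1 := by omega
  have e7 : x.1 7 = 1 := by omega
  have e8 : x.1 8 = 1 := by omega
  rw [e0, e1, e2, e3, e4, e5, e6, e7, e8] at hs
  norm_num at hs

theorem stage1 (x : Exc) (h0 : cc L1 x = 0) : Mv ({L1} : Set Exc) x L2 := by
  by_contra hcon
  have g0 : cc x y10 = 0 := by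
    by_contra hne
    refine hcon (mv_via y10 hne (by decide) ?_ ?_ ?_)
    · simp [h0]
    · simp only [Set.mem_insert_iff, Set.mem_singleton_iff, forall_eq_or_imp, forall_eq]; decide
    · simp only [Set.mem_insert_iff, Set.mem_singleton_iff, forall_eq_or_imp, forall_eq]; decide
  have g1 : cc x y11 = 0 := by
    by_contra hne
    refine hcon (mv_via y11 hne (by decide) ?_ ?_ ?_)
    · simp [h0]
    · simp only [Set.mem_insert_iff, Set.mem_singleton_iff, forall_eq_or_imp, forall_eq]; decide
    · simp only [Set.mem_insert_iff, Set.mem_singleton_iff, forall_eq_or_imp, forall_eq]; decide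
  have g2 : cc x y12 = 0 := by
    by_contra hne
    refine hcon (mv_via y12 hne (by decide) ?_ ?_ ?_)
    · simp [h0]
    · simp only [Set.mem_insert_iff, Set.mem_singleton_iff, forall_eq_or_imp, forall_eq]; decide
    · simp only [Set.mem_insert_iff, Set.mem_singleton_iff, forall_eq_or_imp, forall_eq]; decide
  have g3 : cc x y13 = 0 := by
    by_contra hne
    refine hcon (mv_via y13 hne (by decide) ?_ ?_ ?_)
    · simp [h0]
    · simp only [Set.mem_insert_iff, Set.mem_singleton_iff, forall_eq_or_imp, forall_eq]; decide
    · simp only [Set.mem_insert_iff, Set.mem_singleton_iff, forall_eq_or_imp, forall_eq]; decide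
  have g4 : cc x y14 = 0 := by
    by_contra hne
    refine hcon (mv_via y14 hne (by decide) ?_ ?_ ?_)
    · simp [h0]
    · simp only [Set.mem_insert_iff, Set.mem_singleton_iff, forall_eq_or_imp, forall_eq]; decide
    · simp only [Set.mem_insert_iff, Set.mem_singleton_iff, forall_eq_or_imp, forall_eq]; decide
  have g5 : cc x y15 = 0 := by
    by_contra hne
    refine hcon (mv_via y15 hne (by decide) ?_ ?_ ?_)
    · simp [h0]
    · simp only [Set.mem_insert_iff, Set.mem_singleton_iff, forall_eq_or_imp, forall_eq]; decide
    · simp only [Set.mem_insert_iff, Set.mem_singleton_iff, forall_eq_or_imp, forall_eq]; decide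
  have g6 : cc x y16 = 0 := by
    by_contra hne
    refine hcon (mv_via y16 hne (by decide) ?_ ?_ ?_)
    · simp [h0]
    · simp only [Set.mem_insert_iff, Set.mem_singleton_iff, forall_eq_or_imp, forall_eq]; decide
    · simp only [Set.mem_insert_iff, Set.mem_singleton_iff, forall_eq_or_imp, forall_eq]; decide
  have hK := K_exp x
  have hs := sq_exp x
  simp [cc_exp, y10, y11, y12, y13, y14, y15, y16, L1, l12] at g0 g1 g2 g3 g4 g5 g6 h0
  have e0 : x.1 0 = 3 := by omega
  have e1 : x.1 1 = 1 := by omega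
  have e2 : x.1 2 = 1 := by omega
  have e3 : x.1 3 = 1 := by omega
  have e4 : x.1 4 = 1 := by omega
  have e5 : x.1 5 = 1 := by omega
  have e6 : x.1 6 = 1 := by omega
  have e7 : x.1 7 = 1 := by omega
  have e8 : x.1 8 = 1 := by omega
  rw [e0, e1, e2, e3, e4, e5, e6, e7, e8] at hs
  norm_num at hs

theorem stage2 (x : Exc) (h0 : cc L1 x = 0) (h1 : cc L2 x = 0) : Mv ({L1, L2} : Set Exc) x L3 := by
  by_contra hcon
  have g0 : cc x y20 = 0 := by
    by_contra hne
    refine hcon (mv_via y20 hne (by decide) ?_ ?_ ?_)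
    · simp [h0, h1]
    · simp only [Set.mem_insert_iff, Set.mem_singleton_iff, forall_eq_or_imp, forall_eq]; decide
    · simp only [Set.mem_insert_iff, Set.mem_singleton_iff, forall_eq_or_imp, forall_eq]; decide
  have g1 : cc x y21 = 0 := by
    by_contra hne
    refine hcon (mv_via y21 hne (by decide) ?_ ?_ ?_)
    · simp [h0, h1]
    · simp only [Set.mem_insert_iff, Set.mem_singleton_iff, forall_eq_or_imp, forall_eq]; decide
    · simp only [Set.mem_insert_iff, Set.mem_singleton_iff, forall_eq_or_imp, forall_eq]; decide
  have g2 : cc x y22 = 0 := by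
    by_contra hne
    refine hcon (mv_via y22 hne (by decide) ?_ ?_ ?_)
    · simp [h0, h1]
    · simp only [Set.mem_insert_iff, Set.mem_singleton_iff, forall_eq_or_imp, forall_eq]; decide
    · simp only [Set.mem_insert_iff, Set.mem_singleton_iff, forall_eq_or_imp, forall_eq]; decide
  have g3 : cc x y23 = 0 := by
    by_contra hne
    refine hcon (mv_via y23 hne (by decide) ?_ ?_ ?_)
    · simp [h0, h1]
    · simp only [Set.mem_insert_iff, Set.mem_singleton_iff, forall_eq_or_imp, forall_eq]; decide
    · simp only [Set.mem_insert_iff, Set.mem_singleton_iff, forall_eq_or_imp, forall_eq]; decide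
  have g4 : cc x y24 = 0 := by
    by_contra hne
    refine hcon (mv_via y24 hne (by decide) ?_ ?_ ?_)
    · simp [h0, h1]
    · simp only [Set.mem_insert_iff, Set.mem_singleton_iff, forall_eq_or_imp, forall_eq]; decide
    · simp only [Set.mem_insert_iff, Set.mem_singleton_iff, forall_eq_or_imp, forall_eq]; decide
  have g5 : cc x y25 = 0 := by
    by_contra hne
    refine hcon (mv_via y25 hne (by decide) ?_ ?_ ?_)
    · simp [h0, h1]
    · simp only [Set.mem_insert_iff, Set.mem_singleton_iff, forall_eq_or_imp, forall_eq]; decide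
    · simp only [Set.mem_insert_iff, Set.mem_singleton_iff, forall_eq_or_imp, forall_eq]; decide
  have hK := K_exp x
  have hs := sq_exp x
  simp [cc_exp, y20, y21, y22, y23, y24, y25, L1, L2, l12, l34] at g0 g1 g2 g3 g4 g5 h0 h1
  have e0 : x.1 0 = 3 := by omega
  have e1 : x.1 1 = 1 := by omega
  have e2 : x.1 2 = 1 := by omega
  have e3 : x.1 3 = 1 := by omega
  have e4 : x.1 4 = 1 := by omega
  have e5 : x.1 5 = 1 := by omega
  have e6 : x.1 6 = 1 := by omega
  have e7 : x.1 7 = 1 := by omega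
  have e8 : x.1 8 = 1 := by omega
  rw [e0, e1, e2, e3, e4, e5, e6, e7, e8] at hs
  norm_num at hs

theorem stage3 (x : Exc) (h0 : cc L1 x = 0) (h1 : cc L2 x = 0) (h2 : cc L3 x = 0) (hb : ¬ Bad L1 L2 L3 x) : Mv ({L1, L2, L3} : Set Exc) x L4 := by
  by_contra hcon
  have g0 : cc x y30 = 0 := by
    by_contra hne
    refine hcon (mv_via y30 hne (by decide) ?_ ?_ ?_)
    · simp [h0, h1, h2]
    · simp only [Set.mem_insert_iff, Set.mem_singleton_iff, forall_eq_or_imp, forall_eq]; decide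
    · simp only [Set.mem_insert_iff, Set.mem_singleton_iff, forall_eq_or_imp, forall_eq]; decide
  have g1 : cc x y31 = 0 := by
    by_contra hne
    refine hcon (mv_via y31 hne (by decide) ?_ ?_ ?_)
    · simp [h0, h1, h2]
    · simp only [Set.mem_insert_iff, Set.mem_singleton_iff, forall_eq_or_imp, forall_eq]; decide
    · simp only [Set.mem_insert_iff, Set.mem_singleton_iff, forall_eq_or_imp, forall_eq]; decide
  have g2 : cc x y32 = 0 := by
    by_contra hne
    refine hcon (mv_via y32 hne (by decide) ?_ ?_ ?_)
    · simp [h0, h1, h2]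
    · simp only [Set.mem_insert_iff, Set.mem_singleton_iff, forall_eq_or_imp, forall_eq]; decide
    · simp only [Set.mem_insert_iff, Set.mem_singleton_iff, forall_eq_or_imp, forall_eq]; decide
  have g3 : cc x y33 = 0 := by
    by_contra hne
    refine hcon (mv_via y33 hne (by decide) ?_ ?_ ?_)
    · simp [h0, h1, h2]
    · simp only [Set.mem_insert_iff, Set.mem_singleton_iff, forall_eq_or_imp, forall_eq]; decide
    · simp only [Set.mem_insert_iff, Set.mem_singleton_iff, forall_eq_or_imp, forall_eq]; decide
  have hK := K_exp x
  have hs := sq_exp x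
  simp [cc_exp, y30, y31, y32, y33, L1, L2, L3, l12, l34, l56] at g0 g1 g2 g3 h0 h1 h2
  have e0 : x.1 0 = 3 := by omega
  have e1 : x.1 1 = 1 := by omega
  have e2 : x.1 2 = 1 := by omega
  have e3 : x.1 3 = 1 := by omega
  have e4 : x.1 4 = 1 := by omega
  have e5 : x.1 5 = 1 := by omega
  have e6 : x.1 6 = 1 := by omega
  have e7 : x.1 7 = 2 - x.1 8 := by omega
  rw [e0, e1, e2, e3, e4, e5, e6, e7] at hs
  have hp : x.1 8 * (x.1 8 - 2) = 0 := by linarith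
  rcases mul_eq_zero.1 hp with h8 | h8
  · refine hb ⟨⟨![0, 0, 0, 0, 0, 0, 0, 0, -1], by decide, by decide⟩, by decide, by decide,
      by decide, ?_⟩
    rw [cc_exp]; simp [h8]
  · refine hb ⟨⟨![0, 0, 0, 0, 0, 0, 0, -1, 0], by decide, by decide⟩, by decide, by decide,
      by decide, ?_⟩
    rw [cc_exp]; simp [e7]; omega

theorem bad_pres {g : Exc ≃ Exc} (h : PreservesB g) {a b c d : Exc}
    (hb : Bad (g a) (g b) (g c) (g d)) : Bad a b c d := by
  obtain ⟨z, h1, h2, h3, h4⟩ := hb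
  obtain ⟨w, rfl⟩ := g.surjective z
  rw [cc_pres h] at h1 h2 h3 h4
  exact ⟨w, h1, h2, h3, h4⟩

theorem move_quad {a b c d : Exc} (ab : cc a b = 0) (ac : cc a c = 0) (ad : cc a d = 0)
    (bc : cc b c = 0) (bd : cc b d = 0) (cd : cc c d = 0) (hb : ¬ Bad a b c d) :
    ∃ g : Exc ≃ Exc, PreservesB g ∧ g a = L1 ∧ g b = L2 ∧ g c = L3 ∧ g d = L4 := by
  obtain ⟨g, hg, ga, -⟩ := stage0 a
  obtain ⟨k, hk, kb, kz⟩ := stage1 (g b) (by rw [← ga, cc_pres hg, ab])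
  have k1 := kz L1 (by simp)
  have G2 := pres_trans hg hk
  obtain ⟨l, hl, lc, lz⟩ := stage2 (k (g c)) (by rw [← k1, cc_pres hk, ← ga, cc_pres hg, ac])
    (by rw [← kb, cc_pres hk, cc_pres hg, bc])
  have l1 := lz L1 (by simp)
  have l2 := lz L2 (by simp)
  obtain ⟨m, hm, md, mz⟩ := stage3 (l (k (g d)))
    (by rw [← l1, cc_pres hl, ← k1, cc_pres hk, ← ga, cc_pres hg, ad])
    (by rw [← l2, cc_pres hl, ← kb, cc_pres hk, cc_pres hg, bd])
    (by rw [← lc, cc_pres hl, cc_pres hk, cc_pres hg, cd])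
    (by
      intro hbad
      apply hb
      apply bad_pres hg
      apply bad_pres hk
      apply bad_pres hl
      rwa [ga, k1, l1, kb, l2, lc])
  have m1 := mz L1 (by simp)
  have m2 := mz L2 (by simp)
  have m3 := mz L3 (by simp)
  refine ⟨((g.trans k).trans l).trans m, pres_trans (pres_trans G2 hl) hm, ?_, ?_, ?_, ?_⟩
  · simp [ga, k1, l1, m1]
  · simp [kb, l2, m2]
  · simp [lc, m3]
  · simp [md]

/-- Every `W`-orbit of 10-element cliques in `C` with weights in `{1,2}` contains a clique
containing the classes of the four lines `ℓ_{1,2}`, `ℓ_{3,4}`, `ℓ_{5,6}`, `ℓ_{7,8}`. -/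
theorem stmt10 (S : Finset Exc) (hcard : S.card = 10) (hcl : IsClique {1, 2} S) :
    ∃ T : Finset Exc, T.card = 10 ∧ IsClique {1, 2} T ∧ SameOrbit S T ∧
      (∃ x ∈ T, x.1 = l12) ∧ (∃ x ∈ T, x.1 = l34) ∧
      (∃ x ∈ T, x.1 = l56) ∧ (∃ x ∈ T, x.1 = l78) := by
  have hF : ∀ x ∈ S, ∀ y ∈ S, x ≠ y → cc x y = 0 ∨ cc x y = 1 := by
    intro x hx y hy hxy
    have h := hcl x hx y hy hxy
    simp only [Set.mem_insert_iff, Set.mem_singleton_iff] at h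
    unfold cc
    omega
  obtain ⟨a, ha, b, hb, c, hc, d, hd, ab, ac, ad, bc, bd, cd, hbad⟩ := exists_good S hcard hF
  obtain ⟨g, hg, ga, gb, gc, gd⟩ := move_quad ab ac ad bc bd cd hbad
  refine ⟨S.image g, ?_, ?_, ⟨g, hg, rfl⟩, ⟨g a, Finset.mem_image_of_mem _ ha, by rw [ga]; rfl⟩,
    ⟨g b, Finset.mem_image_of_mem _ hb, by rw [gb]; rfl⟩,
    ⟨g c, Finset.mem_image_of_mem _ hc, by rw [gc]; rfl⟩,
    ⟨g d, Finset.mem_image_of_mem _ hd, by rw [gd]; rfl⟩⟩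
  · rw [Finset.card_image_of_injective _ g.injective, hcard]
  · intro x hx y hy hxy
    obtain ⟨x', hx', rfl⟩ := Finset.mem_image.1 hx
    obtain ⟨y', hy', rfl⟩ := Finset.mem_image.1 hy
    rw [hg]
    exact hcl x' hx' y' hy' (fun h => hxy (by rw [h]))
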